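/- arXiv:1008.1053 — 2 statements merged into one kernel-verified Lean document; each statement's English description precedes it below -/
import Mathlib

section
/- For points in convex position, (4/3)n stabbing points suffice for disks: let P be a finite set of n points in the Euclidean plane in convex position, i.e., every point of P is an extreme point of the convex hull of P. Then there exists a finite set W ⊂ ℝ² with 3·|W| ≤ 4·n such that for every pair of distinct points p, q ∈ P and every c, r with dist(c,p) = dist(c,q) = r, there exists w ∈ W with dist(c,w) < r (equivalently, the witness Delaunay graph DG⁻(P,W) has no edges). -/
abbrev Pl := EuclideanSpace ℝ (Fin 2)

def sqD (c x : Pl) : ℝ := (c 0 - x 0)^2 + (c 1 - x 1)^2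

lemma dist_sq_eq (c x : Pl) : dist c x ^ 2 = sqD c x := by
  rw [EuclideanSpace.dist_eq, Real.sq_sqrt (by positivity)]
  simp [Fin.sum_univ_two, Real.dist_eq, sqD]

lemma sqD_pos {c x : Pl} (h : c ≠ x) : 0 < sqD c x := by
  rw [← dist_sq_eq]; have := dist_pos.2 h; positivity

lemma dist_lt_of_sqD {c x : Pl} {r : ℝ} (hr : 0 ≤ r) (h : sqD c x < r^2) : dist c x < r := by
  rw [← dist_sq_eq] at h
  exact lt_of_pow_lt_pow_left₀ 2 hr h

def ConvPos (P : Finset Pl) : Prop :=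
  ∀ p ∈ P, ∃ a b : ℝ, ∀ q ∈ P, q ≠ p → a * (q 0 - p 0) + b * (q 1 - p 1) < 0

lemma convPos_of_extreme (P : Finset Pl)
    (hconv : (↑P : Set Pl) ⊆ Set.extremePoints ℝ (convexHull ℝ (↑P : Set Pl))) : ConvPos P := by
  intro p hp
  have h1 := hconv hp
  rw [(convex_convexHull ℝ _).mem_extremePoints_iff_mem_sdiff_convexHull_sdiff] at h1
  have h2 : p ∉ convexHull ℝ ((P.erase p : Finset Pl) : Set Pl) := by
    intro h
    refine h1.2 (convexHull_mono ?_ h)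
    intro x hx
    simp only [Finset.coe_erase, Set.mem_sdiff, Set.mem_singleton_iff] at hx ⊢
    exact ⟨subset_convexHull ℝ _ hx.1, hx.2⟩
  obtain ⟨f, u, hf, hu⟩ := geometric_hahn_banach_closed_point (convex_convexHull ℝ _)
    ((Finset.finite_toSet (P.erase p)).isClosed_convexHull (𝕜 := ℝ)) h2
  have key : ∀ x : Pl, f x = f (EuclideanSpace.single 0 1) * x 0 + f (EuclideanSpace.single 1 1) * x 1 := by
    intro x
    have : x = x 0 • EuclideanSpace.single 0 (1:ℝ) + x 1 • EuclideanSpace.single 1 (1:ℝ) := by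
      ext i; fin_cases i <;> simp
    conv_lhs => rw [this]
    rw [map_add, map_smul, map_smul]; simp; ring
  refine ⟨f (EuclideanSpace.single 0 1), f (EuclideanSpace.single 1 1), fun q hq hqp => ?_⟩
  have := hf q (subset_convexHull ℝ _ (by simp [hq, hqp]))
  have h3 := key p
  have h4 := key q
  linarith

lemma exists_unif {α : Type*} (P : Finset α) (Q : α → ℝ → Prop)
    (h : ∀ q ∈ P, ∃ δ₀ > 0, ∀ δ, 0 < δ → δ ≤ δ₀ → Q q δ) : ∃ δ > 0, ∀ q ∈ P, Q q δ := by
  classical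
  suffices ∃ δ₀ > 0, ∀ δ, 0 < δ → δ ≤ δ₀ → ∀ q ∈ P, Q q δ by
    obtain ⟨d, hd, h⟩ := this
    exact ⟨d, hd, h d hd le_rfl⟩
  induction P using Finset.induction_on with
  | empty => exact ⟨1, one_pos, by simp⟩
  | insert a s ha ih =>
    obtain ⟨d1, h1, h1'⟩ := ih (fun q hq => h q (by simp [hq]))
    obtain ⟨d2, h2, h2'⟩ := h a (by simp)
    refine ⟨min d1 d2, lt_min h1 h2, fun δ h0 hle q hq => ?_⟩
    rcases Finset.mem_insert.1 hq with rfl | hq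
    · exact h2' δ h0 (hle.trans (min_le_right _ _))
    · exact h1' δ h0 (hle.trans (min_le_left _ _)) q hq

lemma stab_scalar {A B S T δ K : ℝ} (hδ : 0 < δ) (hS : 0 < S) (hT : δ * |T| ≤ S) (hK : 0 < K)
    (hlt : K * |T| + K * S / δ < S^2 + T^2)
    (h1 : 2 * (B - δ * A) ≤ K) (h2 : 2 * (-B - δ * A) ≤ K)
    (he : 2 * (-(A * S) + B * T) = S^2 + T^2) : False := by
  have hB : 2 * |B| ≤ 2 * δ * A + K := by
    rcases abs_cases B with ⟨h, _⟩ | ⟨h, _⟩ <;> rw [h] <;> linarith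
  have hBT : B * T ≤ |B| * |T| := by rw [← abs_mul]; exact le_abs_self _
  have hT0 := abs_nonneg T
  have h3 : 2 * |B| * |T| ≤ (2 * δ * A + K) * |T| := mul_le_mul_of_nonneg_right hB hT0
  have h5 : 0 < K * S / δ := by positivity
  rcases le_or_gt 0 A with hA | hA
  · have h4 := mul_le_mul_of_nonneg_left hT hA
    nlinarith
  · have hA' : -(2 * A) ≤ K / δ := by
      rw [le_div_iff₀ hδ]; nlinarith [abs_nonneg B]
    have h6 := mul_le_mul_of_nonneg_right hA' hS.le
    have h7 : K / δ * S = K * S / δ := by ring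
    have h8 : δ * A * |T| ≤ 0 := by
      have : 0 ≤ δ * |T| := by positivity
      nlinarith
    nlinarith

lemma witness_pair (P : Finset Pl) (hP : ConvPos P) (p : Pl) (hp : p ∈ P) :
    ∃ w₁ w₂ : Pl, ∀ c : Pl, ∀ q ∈ P, q ≠ p → sqD c q = sqD c p →
      sqD c w₁ < sqD c p ∨ sqD c w₂ < sqD c p := by
  classical
  obtain ⟨a, b, hab⟩ := hP p hp
  set S : Pl → ℝ := fun q => -(a * (q 0 - p 0) + b * (q 1 - p 1)) with hSdef
  set T : Pl → ℝ := fun q => -b * (q 0 - p 0) + a * (q 1 - p 1) with hTdef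
  have hS : ∀ q ∈ P.erase p, 0 < S q := by
    intro q hq
    have := hab q (Finset.mem_of_mem_erase hq) (Finset.ne_of_mem_erase hq)
    simp only [hSdef]; linarith
  obtain ⟨δ, hδ, hδT⟩ := exists_unif (P.erase p) (fun q δ => δ * |T q| ≤ S q) (by
    intro q hq
    refine ⟨S q / (|T q| + 1), div_pos (hS q hq) (by positivity), fun δ h0 hle => ?_⟩
    rw [le_div_iff₀ (by positivity)] at hle
    nlinarith)
  obtain ⟨ε, hε, hεK⟩ := exists_unif (P.erase p) (fun q ε =>
      ε * ((a^2+b^2) * (1 + δ^2)) * |T q| + ε * ((a^2+b^2) * (1 + δ^2)) * S q / δ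
        < S q ^2 + T q ^2) (by
    intro q hq
    have hSq := hS q hq
    set M := (a^2+b^2) * (1 + δ^2) * |T q| + (a^2+b^2) * (1 + δ^2) * S q / δ with hM
    have hM0 : 0 ≤ M := by positivity
    refine ⟨(S q ^2 + T q ^2) / (M + 1), by positivity, fun ε h0 hle => ?_⟩
    rw [le_div_iff₀ (by positivity)] at hle
    have : ε * ((a^2+b^2) * (1 + δ^2)) * |T q| + ε * ((a^2+b^2) * (1 + δ^2)) * S q / δ
      = ε * M := by rw [hM]; ring
    rw [this]; nlinarith)
  refine ⟨!₂[p 0 + ε * (-b - δ * a), p 1 + ε * (a - δ * b)],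
    !₂[p 0 + ε * (b - δ * a), p 1 + ε * (-a - δ * b)], fun c q hq hqp he => ?_⟩
  have hq' : q ∈ P.erase p := by simp [hq, hqp]
  by_contra hcon
  push Not at hcon
  obtain ⟨h1, h2⟩ := hcon
  simp [sqD] at h1 h2 he
  have hN : 0 < a^2 + b^2 := by
    by_contra hN
    have ha : a = 0 := by nlinarith [sq_nonneg a, sq_nonneg b]
    have hb : b = 0 := by nlinarith [sq_nonneg a, sq_nonneg b]
    have := hS q hq'
    simp [hSdef, ha, hb] at this
  have hε2 := hεK q hq'
  refine stab_scalar (A := a * (c 0 - p 0) + b * (c 1 - p 1))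
    (B := -b * (c 0 - p 0) + a * (c 1 - p 1)) hδ (hS q hq') (hδT q hq')
    (K := ε * ((a^2+b^2) * (1 + δ^2))) (by positivity) hε2 ?_ ?_ ?_
  · refine le_of_mul_le_mul_left ?_ hε
    nlinarith
  · refine le_of_mul_le_mul_left ?_ hε
    nlinarith
  · simp only [hSdef, hTdef]
    linear_combination (-(a^2+b^2)) * he

/-- orientation -/
def ori (x y z : Pl) : ℝ := (y 0 - x 0) * (z 1 - x 1) - (y 1 - x 1) * (z 0 - x 0)

lemma exists_key (P : Finset Pl) (hP : ConvPos P) :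
    ∃ m : Pl → ℝ, (∀ x ∈ P, ∀ y ∈ P, m x = m y → x = y) ∧
      ∀ x ∈ P, ∀ y ∈ P, ∀ z ∈ P, m x < m y → m y < m z → 0 < ori x y z := by
  classical
  rcases P.eq_empty_or_nonempty with rfl | ⟨p, hp⟩
  · exact ⟨fun _ => 0, by simp, by simp⟩
  obtain ⟨a, b, hab⟩ := hP p hp
  set L : Pl → ℝ := fun q => -(a * (q 0 - p 0) + b * (q 1 - p 1)) with hL
  set T : Pl → ℝ := fun q => a * (q 1 - p 1) - b * (q 0 - p 0) with hT
  have hLpos : ∀ q ∈ P, q ≠ p → 0 < L q := by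
    intro q hq hqp
    have := hab q hq hqp
    simp only [hL]; linarith
  have hN : ∀ q ∈ P, q ≠ p → 0 < a^2 + b^2 := by
    intro q hq hqp
    by_contra hN
    have ha : a = 0 := by nlinarith [sq_nonneg a, sq_nonneg b]
    have hb : b = 0 := by nlinarith [sq_nonneg a, sq_nonneg b]
    have := hLpos q hq hqp
    simp [hL, ha, hb] at this
  have hdet : ∀ x y : Pl, T y * L x - T x * L y = - ((a^2+b^2) * ori p x y) := by
    intro x y; simp only [hT, hL, ori]; ring
  set m0 : Pl → ℝ := fun q => -(T q / L q) with hm0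
  obtain ⟨B, hB⟩ : ∃ B : ℝ, ∀ q ∈ P, B < m0 q := by
    obtain ⟨B, hB⟩ := (P.finite_toSet.image m0).bddBelow
    exact ⟨B - 1, fun q hq => by
      have := hB (Set.mem_image_of_mem m0 hq); linarith⟩
  have hlt : ∀ x ∈ P, ∀ y ∈ P, x ≠ p → y ≠ p → m0 x < m0 y → 0 < ori p x y := by
    intro x hx y hy hxp hyp h
    have h1 := hLpos x hx hxp
    have h2 := hLpos y hy hyp
    have h3 := hN x hx hxp
    simp only [hm0] at h
    rw [neg_lt_neg_iff, div_lt_div_iff₀ h2 h1] at h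
    have := hdet x y
    by_contra hcon
    push Not at hcon
    nlinarith
  have hinj : ∀ x ∈ P, ∀ y ∈ P, x ≠ p → y ≠ p → L x ≤ L y → m0 x = m0 y → x = y := by
    intro x hx y hy hxp hyp hle h
    by_contra hxy
    have h1 := hLpos x hx hxp
    have h2 := hLpos y hy hyp
    have h3 := hN x hx hxp
    simp only [hm0] at h
    rw [neg_inj, div_eq_div_iff h1.ne' h2.ne'] at h
    obtain ⟨a', b', hab'⟩ := hP x hx
    have e1 := hab' y hy (Ne.symm hxy)
    have e2 := hab' p hp (Ne.symm hxp)
    have f0 : (a^2+b^2) * (L y * (x 0 - p 0) - L x * (y 0 - p 0)) = 0 := by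
      have : (a^2+b^2) * (L y * (x 0 - p 0) - L x * (y 0 - p 0)) = -b * (T x * L y - T y * L x) := by
        simp only [hL, hT]; ring
      rw [this, h]; ring
    have f1 : (a^2+b^2) * (L y * (x 1 - p 1) - L x * (y 1 - p 1)) = 0 := by
      have : (a^2+b^2) * (L y * (x 1 - p 1) - L x * (y 1 - p 1)) = a * (T x * L y - T y * L x) := by
        simp only [hL, hT]; ring
      rw [this, h]; ring
    have g0 := (mul_eq_zero.1 f0).resolve_left h3.ne'
    have g1 := (mul_eq_zero.1 f1).resolve_left h3.ne'
    have : L x * (a' * (y 0 - x 0) + b' * (y 1 - x 1))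
        + (L y - L x) * (a' * (p 0 - x 0) + b' * (p 1 - x 1)) = 0 := by
      linear_combination (-a') * g0 + (-b') * g1
    have k1 := mul_neg_of_pos_of_neg h1 e1
    have k2 := mul_nonpos_of_nonneg_of_nonpos (sub_nonneg.2 hle) e2.le
    linarith
  refine ⟨fun q => if q = p then B else m0 q, ?_, ?_⟩
  · intro x hx y hy h
    by_cases hxp : x = p <;> by_cases hyp : y = p
    · rw [hxp, hyp]
    · simp [hxp, hyp] at h
      exact absurd h (hB y hy).ne
    · simp [hxp, hyp] at h
      exact absurd h (hB x hx).ne'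
    · simp only [hxp, hyp, if_false] at h
      rcases le_total (L x) (L y) with hle | hle
      · exact hinj x hx y hy hxp hyp hle h
      · exact (hinj y hy x hx hyp hxp hle h.symm).symm
  · intro x hx y hy z hz hxy hyz
    have hyp : y ≠ p := by
      rintro rfl
      by_cases hxp : x = y
      · simp [hxp] at hxy
      · simp [hxp] at hxy
        exact absurd hxy (hB x hx).not_gt
    have hzp : z ≠ p := by
      rintro rfl
      simp [hyp] at hyz
      exact absurd hyz (hB y hy).not_gt
    simp only [hyp, hzp, if_false] at hxy hyz
    have o1 := hlt y hy z hz hyp hzp hyz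
    by_cases hxp : x = p
    · rw [hxp]; exact o1
    simp only [hxp, if_false] at hxy
    have o2 := hlt x hx y hy hxp hyp hxy
    have o3 := hlt x hx z hz hxp hzp (hxy.trans hyz)
    by_contra hcon
    push Not at hcon
    obtain ⟨a', b', hab'⟩ := hP y hy
    have e1 := hab' x hx (by rintro rfl; exact lt_irrefl _ hxy)
    have e2 := hab' p hp (Ne.symm hyp)
    have e3 := hab' z hz (by rintro rfl; exact lt_irrefl _ hyz)
    have : ori p y z * (a' * (x 0 - y 0) + b' * (x 1 - y 1))
      + ori p x y * (a' * (z 0 - y 0) + b' * (z 1 - y 1))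
      - ori x y z * (a' * (p 0 - y 0) + b' * (p 1 - y 1)) = 0 := by
      simp only [ori]; ring
    have k1 := mul_neg_of_pos_of_neg o1 e1
    have k2 := mul_neg_of_pos_of_neg o2 e3
    have k3 := mul_nonneg_of_nonpos_of_nonpos hcon e2.le
    linarith

def SAdj (P : Finset Pl) (k t : Pl) : Prop :=
  ∃ (c : Pl) (s : ℝ), sqD c k = s ∧ sqD c t = s ∧ ∀ x ∈ P, x ≠ k → x ≠ t → s < sqD c x

lemma SAdj.symm {P : Finset Pl} {k t : Pl} (h : SAdj P k t) : SAdj P t k := by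
  obtain ⟨c, s, h1, h2, h3⟩ := h
  exact ⟨c, s, h2, h1, fun x hx a b => h3 x hx b a⟩

lemma noncross {P : Finset Pl} {m : Pl → ℝ}
    (hm : ∀ x ∈ P, ∀ y ∈ P, ∀ z ∈ P, m x < m y → m y < m z → 0 < ori x y z)
    {i k j l : Pl} (hi : i ∈ P) (hk : k ∈ P) (hj : j ∈ P) (hl : l ∈ P)
    (h1 : m i < m k) (h2 : m k < m j) (h3 : m j < m l) (hij : SAdj P i j) (hkl : SAdj P k l) :
    False := by
  obtain ⟨c, s, a1, a2, a3⟩ := hij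
  obtain ⟨d, t, b1, b2, b3⟩ := hkl
  have o1 := hm i hi k hk j hj h1 h2
  have o2 := hm i hi j hj l hl (h1.trans h2) h3
  have o3 := hm i hi k hk l hl h1 (h2.trans h3)
  have o4 := hm k hk j hj l hl h2 h3
  have ne : ∀ {x y : Pl}, m x < m y → x ≠ y := by rintro x y h rfl; exact lt_irrefl _ h
  have e1 := a3 k hk (ne h1).symm (ne h2)
  have e2 := a3 l hl (ne (h1.trans (h2.trans h3))).symm (ne h3).symm
  have e3 := b3 i hi (ne h1) (ne (h1.trans (h2.trans h3)))
  have e4 := b3 j hj (ne h2).symm (ne h3)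
  have id : ori k j l * ((sqD c i - s) - (sqD d i - t)) + ori i k l * ((sqD c j - s) - (sqD d j - t))
    = ori i j l * ((sqD c k - s) - (sqD d k - t)) + ori i k j * ((sqD c l - s) - (sqD d l - t)) := by
    simp only [ori, sqD]; ring
  have k1 := mul_pos o4 (sub_pos.2 e3)
  have k2 := mul_pos o3 (sub_pos.2 e4)
  have k3 := mul_pos o2 (sub_pos.2 e1)
  have k4 := mul_pos o1 (sub_pos.2 e2)
  rw [a1, a2, b1, b2] at id
  nlinarith

lemma exists_low {α : Type*} (P : Finset α) (hne : P.Nonempty) (m : α → ℝ)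
    (R : α → α → Prop) (hsymm : ∀ x y, R x y → R y x)
    (hinj : ∀ x ∈ P, ∀ y ∈ P, m x = m y → x = y)
    (hnc : ∀ i ∈ P, ∀ k ∈ P, ∀ j ∈ P, ∀ l ∈ P, m i < m k → m k < m j → m j < m l →
      R i j → R k l → False) :
    ∃ k ∈ P, ∀ t ∈ P, R k t → ∀ z ∈ P, ¬ (m k < m z ∧ m z < m t) ∧ ¬ (m t < m z ∧ m z < m k) := by
  classical
  set bt : α × α → Finset α := fun e => P.filter (fun z => m e.1 < m z ∧ m z < m e.2) with hbt
  set E : Finset (α × α) := (P ×ˢ P).filter (fun e => R e.1 e.2 ∧ (bt e).Nonempty) with hE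
  rcases E.eq_empty_or_nonempty with h0 | hEne
  · obtain ⟨k, hk⟩ := hne
    have key : ∀ x ∈ P, ∀ y ∈ P, R x y → ∀ z ∈ P, ¬ (m x < m z ∧ m z < m y) := by
      intro x hx y hy hR z hz h
      have : (x, y) ∈ E := by
        simp only [hE, Finset.mem_filter, Finset.mem_product]
        exact ⟨⟨hx, hy⟩, hR, z, by simp [hbt, hz, h]⟩
      simp [h0] at this
    exact ⟨k, hk, fun t ht hR z hz => ⟨key k hk t ht hR z hz, key t ht k hk (hsymm _ _ hR) z hz⟩⟩
  · obtain ⟨e, he, hmin⟩ := E.exists_min_image (fun e => (bt e).card) hEne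
    obtain ⟨i, j⟩ := e
    simp only [hE, Finset.mem_filter, Finset.mem_product] at he
    obtain ⟨⟨hi, hj⟩, hR, k, hk⟩ := he
    simp only [hbt, Finset.mem_filter] at hk
    obtain ⟨hkP, hik, hkj⟩ := hk
    have key : ∀ x ∈ P, ∀ y ∈ P, R x y → m i ≤ m x → m y ≤ m j → (x = k ∨ y = k) →
        ∀ z ∈ P, ¬ (m x < m z ∧ m z < m y) := by
      intro x hx y hy hxy h1 h2 h3 z hz h
      have hmem : (x, y) ∈ E := by
        simp only [hE, Finset.mem_filter, Finset.mem_product]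
        exact ⟨⟨hx, hy⟩, hxy, z, by simp [hbt, hz, h]⟩
      have := hmin _ hmem
      have hlt : (bt (x, y)).card < (bt (i, j)).card := by
        apply Finset.card_lt_card
        rw [Finset.ssubset_iff_of_subset]
        · refine ⟨k, by simp [hbt, hkP, hik, hkj], ?_⟩
          rcases h3 with rfl | rfl <;> simp [hbt]
        · intro w hw
          simp only [hbt, Finset.mem_filter] at hw ⊢
          exact ⟨hw.1, lt_of_le_of_lt h1 hw.2.1, lt_of_lt_of_le hw.2.2 h2⟩
      omega
    refine ⟨k, hkP, fun t ht hkt => ?_⟩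
    have ht1 : m t ≤ m j := by
      by_contra h
      push Not at h
      exact hnc i hi k hkP j hj t ht hik hkj h hR hkt
    have ht2 : m i ≤ m t := by
      by_contra h
      push Not at h
      exact hnc t ht i hi k hkP j hj h hik hkj (hsymm _ _ hkt) hR
    exact fun z hz => ⟨key k hkP t ht hkt hik.le ht1 (Or.inl rfl) z hz,
      key t ht k hkP (hsymm _ _ hkt) ht2 hkj.le (Or.inr rfl) z hz⟩

lemma exists_coloring : ∀ (n : ℕ) (P : Finset Pl), P.card = n → ConvPos P →
    ∃ f : Pl → Fin 3, ∀ (c : Pl) (s : ℝ), (∀ x ∈ P, s ≤ sqD c x) →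
      ∀ p ∈ P, ∀ q ∈ P, p ≠ q → sqD c p = s → sqD c q = s →
        ∃ x ∈ P, ∃ y ∈ P, sqD c x = s ∧ sqD c y = s ∧ x ≠ y ∧ f x ≠ f y := by
  classical
  intro n
  induction n with
  | zero =>
    intro P h _
    rw [Finset.card_eq_zero] at h
    subst h
    exact ⟨fun _ => 0, by simp⟩
  | succ n ih =>
    intro P hcard hP
    obtain ⟨m, hinj, hm⟩ := exists_key P hP
    have hne : P.Nonempty := by rw [← Finset.card_pos]; omega
    obtain ⟨k, hk, hlow⟩ := exists_low P hne m (SAdj P) (fun _ _ h => h.symm) hinj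
      (fun i hi k hk j hj l hl h1 h2 h3 a b => noncross hm hi hk hj hl h1 h2 h3 a b)
    obtain ⟨f, hf⟩ := ih (P.erase k) (by rw [Finset.card_erase_of_mem hk]; omega) (by
      intro p hp
      obtain ⟨a, b, hab⟩ := hP p (Finset.mem_of_mem_erase hp)
      exact ⟨a, b, fun q hq => hab q (Finset.mem_of_mem_erase hq)⟩)
    have hU : ((P.erase k).filter (fun t => SAdj P k t ∧ m k < m t)).card ≤ 1 := by
      rw [Finset.card_le_one]
      intro x hx y hy
      simp only [Finset.mem_filter, Finset.mem_erase] at hx hy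
      apply hinj x hx.1.2 y hy.1.2
      apply le_antisymm
      · by_contra h; push Not at h
        exact (hlow x hx.1.2 hx.2.1 y hy.1.2).1 ⟨hy.2.2, h⟩
      · by_contra h; push Not at h
        exact (hlow y hy.1.2 hy.2.1 x hx.1.2).1 ⟨hx.2.2, h⟩
    have hD : ((P.erase k).filter (fun t => SAdj P k t ∧ m t < m k)).card ≤ 1 := by
      rw [Finset.card_le_one]
      intro x hx y hy
      simp only [Finset.mem_filter, Finset.mem_erase] at hx hy
      apply hinj x hx.1.2 y hy.1.2
      apply le_antisymm
      · by_contra h; push Not at h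
        exact (hlow y hy.1.2 hy.2.1 x hx.1.2).2 ⟨h, hx.2.2⟩
      · by_contra h; push Not at h
        exact (hlow x hx.1.2 hx.2.1 y hy.1.2).2 ⟨h, hy.2.2⟩
    set N := ((P.erase k).filter (fun t => SAdj P k t ∧ m k < m t)) ∪
      ((P.erase k).filter (fun t => SAdj P k t ∧ m t < m k)) with hN
    have hNc : (N.image f).card ≤ 2 :=
      Finset.card_image_le.trans ((Finset.card_union_le _ _).trans (by omega))
    obtain ⟨col, hcol⟩ : ∃ col, col ∉ N.image f := by
      by_contra h
      push Not at h
      have : N.image f = Finset.univ := Finset.eq_univ_iff_forall.2 h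
      rw [this] at hNc
      simp at hNc
    have hcol' : ∀ t ∈ P, t ≠ k → SAdj P k t → f t ≠ col := by
      intro t ht htk hadj heq
      apply hcol
      rw [Finset.mem_image]
      refine ⟨t, ?_, heq⟩
      simp only [hN, Finset.mem_union, Finset.mem_filter, Finset.mem_erase]
      rcases lt_trichotomy (m k) (m t) with h | h | h
      · exact Or.inl ⟨⟨htk, ht⟩, hadj, h⟩
      · exact absurd (hinj k hk t ht h).symm htk
      · exact Or.inr ⟨⟨htk, ht⟩, hadj, h⟩
    refine ⟨Function.update f k col, fun c s hemp p hp q hq hpq hps hqs => ?_⟩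
    by_cases hex : ∃ p' ∈ P.erase k, ∃ q' ∈ P.erase k, p' ≠ q' ∧ sqD c p' = s ∧ sqD c q' = s
    · obtain ⟨p', hp', q', hq', hne', h1, h2⟩ := hex
      obtain ⟨x, hx, y, hy, hxs, hys, hxy, hfxy⟩ :=
        hf c s (fun x hx => hemp x (Finset.mem_of_mem_erase hx)) p' hp' q' hq' hne' h1 h2
      rw [Finset.mem_erase] at hx hy
      refine ⟨x, hx.2, y, hy.2, hxs, hys, hxy, ?_⟩
      rwa [Function.update_of_ne hx.1, Function.update_of_ne hy.1]
    · push Not at hex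
      have main : ∀ t ∈ P, t ≠ k → sqD c k = s → sqD c t = s → f t ≠ col := by
        intro t ht htk hks hts
        refine hcol' t ht htk ⟨c, s, hks, hts, fun x hx hxk hxt => ?_⟩
        refine lt_of_le_of_ne (hemp x hx) (fun h => ?_)
        exact hex x (by simp [hx, hxk]) t (by simp [ht, htk]) hxt h.symm hts
      refine ⟨p, hp, q, hq, hps, hqs, hpq, ?_⟩
      by_cases hpk : p = k
      · subst hpk
        rw [Function.update_self, Function.update_of_ne hpq.symm]
        exact (main q hq hpq.symm hps hqs).symm
      · by_cases hqk : q = k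
        · subst hqk
          rw [Function.update_self, Function.update_of_ne hpq]
          exact main p hp hpq hqs hps
        · exact absurd hqs (hex p (by simp [hp, hpk]) q (by simp [hq, hqk]) hpq hps)

lemma shrink (P : Finset Pl) (p q : Pl) (hq : q ∈ P) (hpq : p ≠ q) (c : Pl)
    (he : sqD c q = sqD c p) :
    ∃ c' : Pl, (∀ x ∈ P, sqD c' p ≤ sqD c' x) ∧ (∃ x ∈ P, x ≠ p ∧ sqD c' x = sqD c' p) ∧
      dist c c' + dist c' p = dist c p := by
  classical
  set g : Pl → ℝ := fun x => (c 0 - p 0) * (x 0 - p 0) + (c 1 - p 1) * (x 1 - p 1) with hg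
  have hexp : ∀ (l : ℝ) (x : Pl), sqD (p + l • (c - p)) x - sqD (p + l • (c - p)) p
      = sqD p x - 2 * l * g x := by
    intro l x; simp [sqD, hg]; ring
  have hexp1 : ∀ x, sqD c x - sqD c p = sqD p x - 2 * g x := by
    intro x; simp only [sqD, hg]; ring
  have hgq : 0 < g q := by
    have := hexp1 q; have := sqD_pos hpq; linarith
  obtain ⟨x, hx, hmin⟩ := (P.filter (fun x => 0 < g x)).exists_min_image
    (fun x => sqD p x / (2 * g x)) ⟨q, by simp [hq, hgq]⟩
  rw [Finset.mem_filter] at hx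
  set l := sqD p x / (2 * g x) with hl
  have hgx := hx.2
  have hD0 : ∀ y, 0 ≤ sqD p y := fun y => by simp only [sqD]; positivity
  have hl0 : 0 ≤ l := div_nonneg (hD0 x) (by linarith)
  have hl1 : l ≤ 1 := by
    refine (hmin q (by simp [hq, hgq])).trans ?_
    have := hexp1 q
    rw [div_le_one (by linarith)]; linarith
  have hxp : x ≠ p := by
    rintro rfl; simp [hg] at hgx
  refine ⟨p + l • (c - p), fun y hy => ?_, ⟨x, hx.1, hxp, ?_⟩, ?_⟩
  · have h1 := hexp l y
    have : 2 * l * g y ≤ sqD p y := by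
      rcases le_or_gt (g y) 0 with h | h
      · have := hD0 y; nlinarith
      · have h2 := hmin y (by simp [hy, h])
        rw [le_div_iff₀ (by linarith)] at h2
        linarith
    linarith
  · have h1 := hexp l x
    have : l * (2 * g x) = sqD p x := by rw [hl]; field_simp
    linarith
  · have e1 : c - (p + l • (c - p)) = (1 - l) • (c - p) := by module
    have e2 : p + l • (c - p) - p = l • (c - p) := by module
    rw [dist_eq_norm, dist_eq_norm, dist_eq_norm, e1, e2, norm_smul, norm_smul,
      Real.norm_of_nonneg hl0, Real.norm_of_nonneg (by linarith)]
    ring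

/-- For points in convex position, `(4/3)·n` stabbing points suffice for disks:
if every point of the finite planar set `P` is an extreme point of its convex
hull, then there is a finite set `W` with `3·|W| ≤ 4·|P|` such that every disk
whose bounding circle passes through two distinct points of `P` contains a
witness of `W` in its interior (i.e., `DG⁻(P, W)` has no edges). -/
theorem stabbing_disks_convex_position (P : Finset (EuclideanSpace ℝ (Fin 2)))
    (hconv : (↑P : Set (EuclideanSpace ℝ (Fin 2))) ⊆
      Set.extremePoints ℝ (convexHull ℝ (↑P : Set (EuclideanSpace ℝ (Fin 2))))) :
    ∃ W : Finset (EuclideanSpace ℝ (Fin 2)), 3 * W.card ≤ 4 * P.card ∧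
      ∀ p ∈ P, ∀ q ∈ P, p ≠ q →
        ∀ (c : EuclideanSpace ℝ (Fin 2)) (r : ℝ), dist c p = r → dist c q = r →
          ∃ w ∈ W, dist c w < r := by
  classical
  have hP := convPos_of_extreme P hconv
  obtain ⟨f, hf⟩ := exists_coloring P.card P rfl hP
  have hw : ∀ p : Pl, ∃ w₁ w₂ : Pl, p ∈ P → ∀ c : Pl, ∀ q ∈ P, q ≠ p → sqD c q = sqD c p →
      sqD c w₁ < sqD c p ∨ sqD c w₂ < sqD c p := by
    intro p
    by_cases hp : p ∈ P
    · obtain ⟨w₁, w₂, h⟩ := witness_pair P hP p hp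
      exact ⟨w₁, w₂, fun _ => h⟩
    · exact ⟨p, p, fun h => absurd h hp⟩
  choose w₁ w₂ hw using hw
  obtain ⟨i, hi⟩ : ∃ i : Fin 3, P.card ≤ 3 * (P.filter (fun x => f x = i)).card := by
    by_contra h
    push Not at h
    have h1 := Finset.card_eq_sum_card_fiberwise (s := P) (t := Finset.univ) (f := f) (by simp)
    rw [Fin.sum_univ_three] at h1
    have := h 0
    have := h 1
    have := h 2
    omega
  have hsum : (P.filter (fun x => f x = i)).card + (P.filter (fun x => ¬ f x = i)).card
      = P.card := by
    convert Finset.card_filter_add_card_filter_not (s := P) (fun x => f x = i)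
  set S := P.filter (fun x => ¬ f x = i) with hS
  refine ⟨S.image w₁ ∪ S.image w₂, ?_, ?_⟩
  · have h1 := Finset.card_union_le (S.image w₁) (S.image w₂)
    have h2 : (S.image w₁).card ≤ S.card := Finset.card_image_le
    have h3 : (S.image w₂).card ≤ S.card := Finset.card_image_le
    omega
  · intro p hp q hq hpq c r hcp hcq
    have he : sqD c q = sqD c p := by rw [← dist_sq_eq, ← dist_sq_eq, hcp, hcq]
    obtain ⟨c', hemp, ⟨x, hx, hxp, hxe⟩, hd⟩ := shrink P p q hq hpq c he
    obtain ⟨y, hy, z, hz, hys, hzs, hyz, hfyz⟩ :=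
      hf c' (sqD c' p) hemp p hp x hx hxp.symm rfl hxe
    have main : ∀ u ∈ P, ∀ v ∈ P, u ≠ v → sqD c' u = sqD c' p → sqD c' v = sqD c' p → f u ≠ i →
        ∃ w ∈ S.image w₁ ∪ S.image w₂, dist c w < r := by
      intro u hu v hv huv hus hvs hfu
      have huS : u ∈ S := by simp [hS, hu, hfu]
      have fin : ∀ w, sqD c' w < sqD c' u → dist c w < r := by
        intro w hlt
        rw [hus, ← dist_sq_eq c' p] at hlt
        have := dist_lt_of_sqD dist_nonneg hlt
        have := dist_triangle c c' w
        linarith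
      rcases hw u hu c' v hv huv.symm (hvs.trans hus.symm) with h | h
      · exact ⟨w₁ u, Finset.mem_union_left _ (Finset.mem_image_of_mem _ huS), fin _ h⟩
      · exact ⟨w₂ u, Finset.mem_union_right _ (Finset.mem_image_of_mem _ huS), fin _ h⟩
    by_cases hfy : f y = i
    · exact main z hz y hy hyz.symm hzs hys (fun h => hfyz (hfy.trans h.symm))
    · exact main y hy z hz hyz hys hzs hfy
end

section
/- Let a, b, w₁, w₂ be points in the Euclidean plane such that w₁ and w₂ lie strictly on opposite sides of the line through a and b (a ≠ b), and suppose the angles satisfy ∠(a, w₁, b) + ∠(a, w₂, b) > π. Then every disk whose bounding circle passes through a and b contains w₁ or w₂ in its interior: for all c ∈ ℝ² and r with dist(c,a) = dist(c,b) = r, either dist(c,w₁) < r or dist(c,w₂) < r. -/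
lemma osd_sin (x y : EuclideanSpace ℝ (Fin 2)) :
    Real.sin (InnerProductGeometry.angle x y) * (‖x‖ * ‖y‖) = |x 0 * y 1 - x 1 * y 0| := by
  rw [InnerProductGeometry.sin_angle_mul_norm_mul_norm, ← Real.sqrt_sq_eq_abs]
  congr 1
  simp only [PiLp.inner_apply, Fin.sum_univ_two, RCLike.inner_apply, conj_trivial]
  ring

lemma osd_cos (x y : EuclideanSpace ℝ (Fin 2)) :
    Real.cos (InnerProductGeometry.angle x y) * (‖x‖ * ‖y‖) = x 0 * y 0 + x 1 * y 1 := by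
  rw [InnerProductGeometry.cos_angle_mul_norm_mul_norm]
  simp only [PiLp.inner_apply, Fin.sum_univ_two, RCLike.inner_apply, conj_trivial]
  ring

lemma osd_perp (u0 u1 n0 n1 : ℝ) (hu : 0 < u0 ^ 2 + u1 ^ 2) (h : n0 * u0 + n1 * u1 = 0) :
    ∃ t, n0 = -t * u1 ∧ n1 = t * u0 := by
  refine ⟨(n1 * u0 - n0 * u1) / (u0 ^ 2 + u1 ^ 2), ?_, ?_⟩
  · field_simp
    linear_combination u0 * h
  · field_simp
    linear_combination u1 * h

lemma osd_sinsum (x y z w : EuclideanSpace ℝ (Fin 2))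
    (h1 : x 0 * y 1 - x 1 * y 0 ≠ 0) (h2 : z 0 * w 1 - z 1 * w 0 ≠ 0)
    (h : Real.pi < InnerProductGeometry.angle x y + InnerProductGeometry.angle z w) :
    |x 0 * y 1 - x 1 * y 0| * (z 0 * w 0 + z 1 * w 1) +
      (x 0 * y 0 + x 1 * y 1) * |z 0 * w 1 - z 1 * w 0| < 0 := by
  have p1 := abs_pos.2 h1
  have p2 := abs_pos.2 h2
  rw [← osd_sin] at p1 p2
  rw [← osd_sin, ← osd_sin, ← osd_cos, ← osd_cos]
  have n1 : 0 < ‖x‖ * ‖y‖ := by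
    rcases (by positivity : 0 ≤ ‖x‖ * ‖y‖).lt_or_eq with h | h
    · exact h
    · rw [← h] at p1; simp at p1
  have n2 : 0 < ‖z‖ * ‖w‖ := by
    rcases (by positivity : 0 ≤ ‖z‖ * ‖w‖).lt_or_eq with h | h
    · exact h
    · rw [← h] at p2; simp at p2
  have l1 : InnerProductGeometry.angle x y < Real.pi := by
    rcases (InnerProductGeometry.angle_le_pi x y).lt_or_eq with h | h
    · exact h
    · rw [h] at p1; simp at p1
  have l2 := InnerProductGeometry.angle_le_pi z w
  have hs : Real.sin (InnerProductGeometry.angle x y + InnerProductGeometry.angle z w) < 0 := by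
    have := Real.sin_neg_of_neg_of_neg_pi_lt
      (x := InnerProductGeometry.angle x y + InnerProductGeometry.angle z w - 2 * Real.pi)
      (by linarith) (by linarith)
    rwa [Real.sin_sub_two_pi] at this
  rw [Real.sin_add] at hs
  have := mul_neg_of_neg_of_pos hs (mul_pos n1 n2)
  linarith

lemma osd_distsq (x y : EuclideanSpace ℝ (Fin 2)) :
    dist x y ^ 2 = (x 0 - y 0) ^ 2 + (x 1 - y 1) ^ 2 := by
  rw [EuclideanSpace.dist_eq, Real.sq_sqrt (by positivity)]
  simp [Fin.sum_univ_two, Real.dist_eq, sq_abs]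

lemma osd_affine (f : EuclideanSpace ℝ (Fin 2) →ᵃ[ℝ] ℝ) :
    ∃ g0 g1 : ℝ, ∀ x y, f x - f y = g0 * (x 0 - y 0) + g1 * (x 1 - y 1) := by
  refine ⟨f.linear (EuclideanSpace.single 0 1), f.linear (EuclideanSpace.single 1 1), ?_⟩
  intro x y
  have h : x - y = (x 0 - y 0) • EuclideanSpace.single (0 : Fin 2) (1 : ℝ)
      + (x 1 - y 1) • EuclideanSpace.single (1 : Fin 2) (1 : ℝ) := by
    ext i; fin_cases i <;> simp
  have := f.linearMap_vsub x y
  simp only [vsub_eq_sub] at this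
  rw [← this, h, map_add, map_smul, map_smul, smul_eq_mul, smul_eq_mul]
  ring

lemma osd_opp (l x y : ℝ) (f1 : l * x < 0) (f2 : 0 < l * y) : |x| * y + x * |y| = 0 := by
  rcases mul_neg_iff.1 f1 with ⟨h1, h2⟩ | ⟨h1, h2⟩
  · have h3 : 0 < y := (mul_pos_iff_of_pos_left h1).1 f2
    rw [abs_of_neg h2, abs_of_pos h3]; ring
  · have h3 : y < 0 := neg_of_mul_pos_right f2 h1.le
    rw [abs_of_pos h2, abs_of_neg h3]; ring

open EuclideanGeometry in
/-- If `w₁` and `w₂` lie strictly on opposite sides of the line through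
`a ≠ b`, and `∠ a w₁ b + ∠ a w₂ b > π`, then every disk whose bounding circle
passes through `a` and `b` contains `w₁` or `w₂` in its interior. -/
theorem opposite_angles_stab_disks (a b w₁ w₂ : EuclideanSpace ℝ (Fin 2))
    (hab : a ≠ b)
    (hsep : ∃ f : EuclideanSpace ℝ (Fin 2) →ᵃ[ℝ] ℝ,
      f a = 0 ∧ f b = 0 ∧ f w₁ < 0 ∧ 0 < f w₂)
    (hangle : Real.pi < ∠ a w₁ b + ∠ a w₂ b) :
    ∀ (c : EuclideanSpace ℝ (Fin 2)) (r : ℝ), dist c a = r → dist c b = r →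
      dist c w₁ < r ∨ dist c w₂ < r := by
  intro c r ha hb
  obtain ⟨f, fa, fb, f1, f2⟩ := hsep
  obtain ⟨g0, g1, hg⟩ := osd_affine f
  have hr : 0 ≤ r := ha ▸ dist_nonneg
  have hu : 0 < (b 0 - a 0) ^ 2 + (b 1 - a 1) ^ 2 := by
    rw [← osd_distsq]
    have := dist_pos.2 hab.symm
    positivity
  obtain ⟨l, hl0, hl1⟩ := osd_perp _ _ g0 g1 hu (by rw [← hg, fa, fb]; ring)
  have ea := osd_distsq c a
  have eb := osd_distsq c b
  rw [ha] at ea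
  rw [hb] at eb
  obtain ⟨t, ht0, ht1⟩ := osd_perp _ _ (a 0 + b 0 - 2 * c 0) (a 1 + b 1 - 2 * c 1) hu
    (by linear_combination ea - eb)
  have k1 := hg w₁ a
  have k2 := hg w₂ a
  rw [fa, sub_zero, hl0, hl1] at k1 k2
  have e1 := osd_distsq c w₁
  have e2 := osd_distsq c w₂
  unfold EuclideanGeometry.angle at hangle
  simp only [vsub_eq_sub] at hangle
  set K : EuclideanSpace ℝ (Fin 2) → ℝ := fun w =>
    (a 0 - w 0) * (b 1 - w 1) - (a 1 - w 1) * (b 0 - w 0) with hK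
  set D : EuclideanSpace ℝ (Fin 2) → ℝ := fun w =>
    (a 0 - w 0) * (b 0 - w 0) + (a 1 - w 1) * (b 1 - w 1) with hD
  have k1' : f w₁ = l * K w₁ := by rw [k1, hK]; ring
  have k2' : f w₂ = l * K w₂ := by rw [k2, hK]; ring
  have hP : ∀ w : EuclideanSpace ℝ (Fin 2),
      (c 0 - w 0) ^ 2 + (c 1 - w 1) ^ 2 - r ^ 2 = D w + t * K w := by
    intro w
    simp only [hK, hD]
    linear_combination (w 0 - a 0) * ht0 + (w 1 - a 1) * ht1 - ea
  have n1 : K w₁ ≠ 0 := by intro h; rw [k1', h] at f1; simp at f1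
  have n2 : K w₂ ≠ 0 := by intro h; rw [k2', h] at f2; simp at f2
  have key : |K w₁| * D w₂ + D w₁ * |K w₂| < 0 := by
    have := osd_sinsum (a - w₁) (b - w₁) (a - w₂) (b - w₂)
      (by simpa [hK] using n1) (by simpa [hK] using n2) hangle
    simpa [hK, hD] using this
  have hopp : |K w₁| * K w₂ + K w₁ * |K w₂| = 0 := by
    rw [k1'] at f1
    rw [k2'] at f2
    exact osd_opp l _ _ f1 f2
  by_contra! hcon
  obtain ⟨c1, c2⟩ := hcon
  have q1 := pow_le_pow_left₀ hr c1 2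
  have q2 := pow_le_pow_left₀ hr c2 2
  have P1 : 0 ≤ D w₁ + t * K w₁ := by rw [← hP]; linarith
  have P2 : 0 ≤ D w₂ + t * K w₂ := by rw [← hP]; linarith
  have m1 := mul_nonneg (abs_nonneg (K w₂)) P1
  have m2 := mul_nonneg (abs_nonneg (K w₁)) P2
  have : t * (|K w₁| * K w₂ + K w₁ * |K w₂|) = 0 := by rw [hopp, mul_zero]
  linarith
end
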